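/- Fix N ≥ 1 and k > 0, and let G : ℝ^N → ℝ^N be differentiable with each component G_i convex and each partial derivative ∂G_i/∂u_j locally Lipschitz. Suppose there exists (M*, U*) ∈ ℝ^N × ℝ^N with all components m*_i > 0, (1/N)Σ_{i=1}^N m*_i = 1, and F̃(M*, U*) = 0. Then for every initial condition (M⁰, U⁰) ∈ ℝ^N × ℝ^N with all m⁰_i > 0 and (1/N)Σ_{i=1}^N m⁰_i = 1, the discrete Hessian Riemannian flow (Ṁ, U̇) = −F̄(M, U), (M(0), U(0)) = (M⁰, U⁰), admits a unique solution (M(t), U(t)) defined on [0, +∞), and all components m_i(t) remain strictly positive for all t ≥ 0. -/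

import Mathlib

/-- The discrete entropy-penalized effective Hamiltonian
`H̃(M,U) = (∑ᵢ (mᵢ Gᵢ(U) − (1/k) mᵢ ln mᵢ)) / (∑ᵢ mᵢ)`. -/
noncomputable def Htilde {N : ℕ} (k : ℝ) (G : (Fin N → ℝ) → (Fin N → ℝ))
    (M U : Fin N → ℝ) : ℝ :=
  (∑ i, (M i * G U i - (1 / k) * (M i * Real.log (M i)))) / ∑ i, M i

/-- First block of `F̃(M,U)`: `(−Gᵢ(U) + H̃(M,U) + (1/k) ln mᵢ)ᵢ`. -/
noncomputable def Ftilde1 {N : ℕ} (k : ℝ) (G : (Fin N → ℝ) → (Fin N → ℝ))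
    (M U : Fin N → ℝ) (i : Fin N) : ℝ :=
  -(G U i) + Htilde k G M U + (1 / k) * Real.log (M i)

/-- Second block of `F̃(M,U)` (and of `F̄(M,U)`): the vector `DG(U)ᵀ M`. -/
noncomputable def Ftilde2 {N : ℕ} (G : (Fin N → ℝ) → (Fin N → ℝ))
    (M U : Fin N → ℝ) (j : Fin N) : ℝ :=
  ∑ i, M i * (fderiv ℝ G U) (Pi.single j 1) i

/-- First block of `F̄(M,U)`: `(mᵢ(−Gᵢ(U) + H̃(M,U) + (1/k) ln mᵢ))ᵢ`. -/
noncomputable def Fbar1 {N : ℕ} (k : ℝ) (G : (Fin N → ℝ) → (Fin N → ℝ))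
    (M U : Fin N → ℝ) (i : Fin N) : ℝ :=
  M i * Ftilde1 k G M U i

open Set Metric

theorem hrf_ode_unique {E : Type*} [NormedAddCommGroup E] [NormedSpace ℝ E]
    {f : E → E} (hf : LocallyLipschitz f) {x y : ℝ → E} {a b t₀ : ℝ} (ht : t₀ ∈ Ico a b)
    (ha : t₀ = a ∨ a < t₀)
    (hx : ∀ t ∈ Icc a b, HasDerivAt x (f (x t)) t)
    (hy : ∀ t ∈ Icc a b, HasDerivAt y (f (y t)) t) (h0 : x t₀ = y t₀) :
    EqOn x y (Icc a b) := by
  have cx : ContinuousOn x (Icc a b) := fun t ht => (hx t ht).continuousAt.continuousWithinAt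
  have cy : ContinuousOn y (Icc a b) := fun t ht => (hy t ht).continuousAt.continuousWithinAt
  have hK : IsCompact (x '' Icc a b ∪ y '' Icc a b) :=
    (isCompact_Icc.image_of_continuousOn cx).union (isCompact_Icc.image_of_continuousOn cy)
  obtain ⟨K, hK⟩ := (hf.locallyLipschitzOn (s := x '' Icc a b ∪ y '' Icc a b)).exists_lipschitzOnWith_of_compact hK
  have mx : ∀ t ∈ Icc a b, x t ∈ x '' Icc a b ∪ y '' Icc a b :=
    fun t ht => Or.inl (mem_image_of_mem _ ht)
  have my : ∀ t ∈ Icc a b, y t ∈ x '' Icc a b ∪ y '' Icc a b :=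
    fun t ht => Or.inr (mem_image_of_mem _ ht)
  rcases ha with ha | ha
  · subst ha
    exact ODE_solution_unique_of_mem_Icc_right (v := fun _ => f) (fun t _ => hK) cx
      (fun t ht => (hx t (Ico_subset_Icc_self ht)).hasDerivWithinAt)
      (fun t ht => mx t (Ico_subset_Icc_self ht)) cy
      (fun t ht => (hy t (Ico_subset_Icc_self ht)).hasDerivWithinAt)
      (fun t ht => my t (Ico_subset_Icc_self ht)) h0
  · exact ODE_solution_unique_of_mem_Icc (v := fun _ => f) (fun t _ => hK) ⟨ha, ht.2⟩ cx
      (fun t ht => hx t (Ioo_subset_Icc_self ht))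
      (fun t ht => mx t (Ioo_subset_Icc_self ht)) cy
      (fun t ht => hy t (Ioo_subset_Icc_self ht))
      (fun t ht => my t (Ioo_subset_Icc_self ht)) h0

theorem hrf_ode_bounded {E : Type*} [NormedAddCommGroup E] [NormedSpace ℝ E]
    [FiniteDimensional ℝ E] {f : E → E} (hf : LocallyLipschitz f) {C : ℝ}
    (hC : ∀ x, ‖f x‖ ≤ C) (x₀ : E) :
    ∃ x : ℝ → E, x 0 = x₀ ∧ ∀ t, HasDerivAt x (f (x t)) t := by
  have : ProperSpace E := FiniteDimensional.proper ℝ E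
  have : CompleteSpace E := FiniteDimensional.complete ℝ E
  have hC0 : 0 ≤ C := (norm_nonneg _).trans (hC x₀)
  have key : ∀ T : ℝ, 0 < T → ∃ x : ℝ → E, x 0 = x₀ ∧
      ∀ t ∈ Ioo (-T) T, HasDerivAt x (f (x t)) t := by
    intro T hT
    obtain ⟨K, hK⟩ := (hf.locallyLipschitzOn
      (s := closedBall x₀ (C * T))).exists_lipschitzOnWith_of_compact (isCompact_closedBall _ _)
    have hp : IsPicardLindelof (fun _ => f) (⟨0, by constructor <;> linarith⟩ : Icc (-T) T) x₀
        (⟨C * T, by positivity⟩ : NNReal) 0 ⟨C, hC0⟩ K := by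
      refine ⟨fun t _ => hK, fun x _ => continuousOn_const, fun t _ x _ => hC x, ?_⟩
      simp only [sub_zero, zero_sub, neg_neg, max_self, NNReal.coe_zero]
      exact le_refl (C * T)
    obtain ⟨x, h0, hx⟩ := hp.exists_eq_forall_mem_Icc_hasDerivWithinAt₀
    exact ⟨x, h0, fun t ht => (hx t (Ioo_subset_Icc_self ht)).hasDerivAt
      (Icc_mem_nhds ht.1 ht.2)⟩
  choose! α h0 hα using key
  refine ⟨fun t => α (|t| + 1) t, h0 _ (by positivity), fun t => ?_⟩
  have heq : ∀ s ∈ ball t 1, α (|s| + 1) s = α (|t| + 2) s := by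
    intro s hs
    rw [mem_ball, Real.dist_eq] at hs
    have h1 : |s| < |t| + 1 := by
      have := abs_sub_abs_le_abs_sub s t
      linarith
    have h2 : (0:ℝ) ≤ |s| := abs_nonneg s
    refine hrf_ode_unique hf (a := -(|s| + 1/2)) (b := |s| + 1/2) (t₀ := 0)
      ⟨by linarith, by linarith⟩ (Or.inr (by linarith)) ?_ ?_ ?_ ?_
    · intro r hr
      exact hα _ (by positivity) r ⟨by linarith [hr.1], by linarith [hr.2]⟩
    · intro r hr
      exact hα _ (by positivity) r ⟨by linarith [hr.1], by linarith [hr.2]⟩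
    · rw [h0 _ (by positivity), h0 _ (by positivity)]
    · exact ⟨by linarith [neg_abs_le s], by linarith [le_abs_self s]⟩
  have := hα (|t| + 2) (by positivity) t
    ⟨by linarith [neg_abs_le t], by linarith [le_abs_self t]⟩
  have e := heq t (mem_ball_self one_pos)
  show HasDerivAt (fun t => α (|t| + 1) t) (f (α (|t| + 1) t)) t
  rw [e]
  exact this.congr_of_eventuallyEq (Filter.eventually_of_mem (ball_mem_nhds t one_pos) heq)

theorem hrf_lip_smul {E F : Type*} [NormedAddCommGroup E] [NormedSpace ℝ E]
    [NormedAddCommGroup F] [NormedSpace ℝ F] {c : E → ℝ} {f : E → F}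
    (hc : LocallyLipschitz c) (hf : LocallyLipschitz f) :
    LocallyLipschitz (fun x => c x • f x) := by
  have h : ContDiff ℝ 1 (fun p : ℝ × F => p.1 • p.2) := contDiff_fst.smul contDiff_snd
  exact h.locallyLipschitz.comp (hc.prodMk hf)

theorem hrf_lip_pi {E : Type*} [NormedAddCommGroup E] [NormedSpace ℝ E]
    {n : ℕ} {f : E → Fin n → ℝ} (hf : ∀ i, LocallyLipschitz (fun x => f x i)) :
    LocallyLipschitz f := by
  intro x
  choose K t ht hK using fun i => hf i x
  refine ⟨∑ i, K i, ⋂ i, t i, Filter.iInter_mem.2 ht, ?_⟩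
  refine LipschitzOnWith.of_dist_le_mul fun y hy z hz => ?_
  rw [dist_pi_le_iff (by positivity)]
  intro i
  refine ((hK i).dist_le_mul y (mem_iInter.1 hy i) z (mem_iInter.1 hz i)).trans ?_
  gcongr
  exact Finset.single_le_sum (f := K) (fun _ _ => zero_le) (Finset.mem_univ i)

theorem hrf_ode_global {E : Type*} [NormedAddCommGroup E] [NormedSpace ℝ E]
    [FiniteDimensional ℝ E] {f : E → E} (hf : LocallyLipschitz f) (x₀ : E) (R : ℝ)
    (hap : ∀ c : E → ℝ, (∀ x, 0 ≤ c x) → ∀ x : ℝ → E, x 0 = x₀ →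
      (∀ t, HasDerivAt x (c (x t) • f (x t)) t) → ∀ t, 0 ≤ t → ‖x t‖ ≤ R) :
    ∃ x : ℝ → E, x 0 = x₀ ∧ ∀ t, 0 ≤ t → HasDerivAt x (f (x t)) t := by
  have : ProperSpace E := FiniteDimensional.proper ℝ E
  let c : E → ℝ := fun x => max 0 (min 1 (R + 1 - ‖x‖))
  have hc : LocallyLipschitz c := by
    have h : LocallyLipschitz (fun x : E => R + 1 - ‖x‖) := by
      refine LipschitzWith.locallyLipschitz (K := 1) (LipschitzWith.of_dist_le_mul fun x y => ?_)
      rw [Real.dist_eq, dist_eq_norm]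
      have := abs_norm_sub_norm_le x y
      rw [show R + 1 - ‖x‖ - (R + 1 - ‖y‖) = -(‖x‖ - ‖y‖) by ring, abs_neg]
      simpa using this
    exact (h.const_min 1).const_max 0
  have hc0 : ∀ x, 0 ≤ c x := fun x => le_max_left _ _
  have hc1 : ∀ x, c x ≤ 1 := fun x => max_le zero_le_one (min_le_left _ _)
  obtain ⟨C, hC⟩ := (isCompact_closedBall (0:E) (R + 1)).exists_bound_of_continuousOn
    hf.continuous.continuousOn
  have hb : ∀ x, ‖c x • f x‖ ≤ max C 0 := by
    intro x
    by_cases hx : x ∈ closedBall (0:E) (R + 1)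
    · rw [norm_smul, Real.norm_of_nonneg (hc0 x)]
      calc c x * ‖f x‖ ≤ 1 * ‖f x‖ := by gcongr; exact hc1 x
        _ ≤ C := by rw [one_mul]; exact hC x hx
        _ ≤ _ := le_max_left _ _
    · have : c x = 0 := by
        apply max_eq_left
        refine (min_le_right _ _).trans ?_
        simp at hx
        linarith
      simp [this]
  obtain ⟨x, h0, hx⟩ := hrf_ode_bounded (hrf_lip_smul hc hf) hb x₀
  refine ⟨x, h0, fun t ht => ?_⟩
  have h1 : c (x t) = 1 := by
    have := hap c hc0 x h0 hx t ht
    show max 0 (min 1 (R + 1 - ‖x t‖)) = 1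
    rw [min_eq_left (by linarith), max_eq_right zero_le_one]
  have := hx t
  rwa [h1, one_smul] at this

theorem hrf_convex_grad {N : ℕ} {G : (Fin N → ℝ) → (Fin N → ℝ)}
    (hGdiff : Differentiable ℝ G) {i : Fin N}
    (hconv : ConvexOn ℝ Set.univ (fun U => G U i)) (U V : Fin N → ℝ) :
    G U i + ∑ j, (V j - U j) * (fderiv ℝ G U) (Pi.single j 1) i ≤ G V i := by
  have hsum : ∑ j, (V j - U j) * (fderiv ℝ G U) (Pi.single j 1) i = fderiv ℝ G U (V - U) i := by
    conv_rhs => rw [pi_eq_sum_univ' (V - U)]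
    simp [map_sum, Finset.sum_apply]
  rw [hsum]
  have hl : HasDerivAt (fun t : ℝ => U + t • (V - U)) (V - U) 0 := by
    simpa using ((hasDerivAt_id (0:ℝ)).smul_const (V - U)).const_add U
  have hG : HasFDerivAt G (fderiv ℝ G U) (U + (0:ℝ) • (V - U)) := by
    simpa using (hGdiff U).hasFDerivAt
  have hd : HasDerivAt (fun t : ℝ => G (U + t • (V - U)) i) (fderiv ℝ G U (V - U) i) 0 :=
    hasDerivAt_pi.1 (hG.comp_hasDerivAt (0:ℝ) hl) i
  have hc : ConvexOn ℝ Set.univ (fun t : ℝ => G (U + t • (V - U)) i) := by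
    have := hconv.comp_affineMap (AffineMap.lineMap U V : ℝ →ᵃ[ℝ] (Fin N → ℝ))
    refine (by simpa using this : ConvexOn ℝ Set.univ _).congr ?_
    intro t _
    simp [AffineMap.lineMap_apply, add_comm]
  have := hc.le_slope_of_hasDerivAt (mem_univ 0) (mem_univ 1) one_pos hd
  simp only [slope_def_field, one_smul, zero_smul, add_zero, sub_zero, div_one,
    add_sub_cancel] at this
  linarith

theorem hrf_mass {N : ℕ} (k : ℝ) (G : (Fin N → ℝ) → (Fin N → ℝ)) (M U : Fin N → ℝ)
    (hM : ∑ i, M i ≠ 0) : ∑ i, M i * Ftilde1 k G M U i = 0 := by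
  have : ∑ i, M i * Ftilde1 k G M U i = (∑ i, M i) * Htilde k G M U
      - ∑ i, (M i * G U i - (1 / k) * (M i * Real.log (M i))) := by
    rw [Finset.sum_mul, ← Finset.sum_sub_distrib]
    refine Finset.sum_congr rfl fun i _ => ?_
    unfold Ftilde1
    ring
  rw [this, Htilde, mul_div_cancel₀ _ hM, sub_self]

theorem hrf_lyapunov {N : ℕ} {k : ℝ} (hk : 0 < k)
    {G : (Fin N → ℝ) → (Fin N → ℝ)} (hGdiff : Differentiable ℝ G)
    (hGconv : ∀ i : Fin N, ConvexOn ℝ Set.univ (fun U => G U i))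
    {Ms Us : Fin N → ℝ} (hMs : ∀ i, 0 < Ms i)
    (hstar1 : ∀ i, Ftilde1 k G Ms Us i = 0) (hstar2 : ∀ j, Ftilde2 G Ms Us j = 0)
    {M : Fin N → ℝ} (U : Fin N → ℝ) (hM : ∀ i, 0 < M i) (hmass : ∑ i, M i = ∑ i, Ms i)
    (hne : ∑ i, M i ≠ 0) :
    ∑ i, Ms i * Ftilde1 k G M U i - ∑ j, (U j - Us j) * Ftilde2 G M U j ≤ 0 := by
  have h1 := hrf_mass k G M U hne
  have e2 : ∀ (A B : Fin N → ℝ), ∑ j, (U j - Us j) * Ftilde2 G A B j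
      = ∑ i, A i * ∑ j, (U j - Us j) * (fderiv ℝ G B) (Pi.single j 1) i := by
    intro A B
    simp only [Ftilde2, Finset.mul_sum]
    rw [Finset.sum_comm]
    refine Finset.sum_congr rfl fun i _ => Finset.sum_congr rfl fun j _ => by ring
  have h2 : ∑ i, Ms i * ∑ j, (U j - Us j) * (fderiv ℝ G Us) (Pi.single j 1) i = 0 := by
    rw [← e2]; simp [hstar2]
  have h3 : ∑ i, (Ms i - M i) * Ftilde1 k G Ms Us i = 0 := by simp [hstar1]
  have h4 : ∑ i, (Ms i - M i) * (Htilde k G M U - Htilde k G Ms Us) = 0 := by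
    rw [← Finset.sum_mul, Finset.sum_sub_distrib, hmass, sub_self, zero_mul]
  rw [e2]
  have : ∑ i, Ms i * Ftilde1 k G M U i
      - ∑ i, M i * ∑ j, (U j - Us j) * (fderiv ℝ G U) (Pi.single j 1) i
      = ∑ i, (Ms i * Ftilde1 k G M U i - M i * Ftilde1 k G M U i
        - M i * ∑ j, (U j - Us j) * (fderiv ℝ G U) (Pi.single j 1) i
        + Ms i * ∑ j, (U j - Us j) * (fderiv ℝ G Us) (Pi.single j 1) i
        - (Ms i - M i) * Ftilde1 k G Ms Us i
        - (Ms i - M i) * (Htilde k G M U - Htilde k G Ms Us)) := by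
    simp only [Finset.sum_sub_distrib, Finset.sum_add_distrib, h1, h2]
    rw [h3, h4]; ring
  rw [this]
  refine Finset.sum_nonpos fun i _ => ?_
  have c1 := hrf_convex_grad hGdiff (hGconv i) U Us
  have c2 := hrf_convex_grad hGdiff (hGconv i) Us U
  have c1' : ∑ j, (Us j - U j) * (fderiv ℝ G U) (Pi.single j 1) i
      = - ∑ j, (U j - Us j) * (fderiv ℝ G U) (Pi.single j 1) i := by
    rw [← Finset.sum_neg_distrib]
    exact Finset.sum_congr rfl fun j _ => by ring
  rw [c1'] at c1
  generalize ∑ j, (U j - Us j) * (fderiv ℝ G U) (Pi.single j 1) i = p at *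
  generalize ∑ j, (U j - Us j) * (fderiv ℝ G Us) (Pi.single j 1) i = q at *
  have c3 : (Ms i - M i) * (Real.log (M i) - Real.log (Ms i)) ≤ 0 := by
    rcases le_total (M i) (Ms i) with h | h
    · exact mul_nonpos_of_nonneg_of_nonpos (by linarith)
        (by linarith [Real.log_le_log (hM i) h])
    · exact mul_nonpos_of_nonpos_of_nonneg (by linarith)
        (by linarith [Real.log_le_log (hMs i) h])
  have c4 : (1 / k) * ((Ms i - M i) * (Real.log (M i) - Real.log (Ms i))) ≤ 0 :=
    mul_nonpos_of_nonneg_of_nonpos (by positivity) c3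
  have c5 := mul_le_mul_of_nonneg_left c1 (hM i).le
  have c6 := mul_le_mul_of_nonneg_left c2 (hMs i).le
  unfold Ftilde1
  linarith

/-- The flow in logarithmic coordinates. -/
noncomputable def hrfField {N : ℕ} (k : ℝ) (G : (Fin N → ℝ) → (Fin N → ℝ))
    (x : (Fin N → ℝ) × (Fin N → ℝ)) : (Fin N → ℝ) × (Fin N → ℝ) :=
  (fun i => -(Ftilde1 k G (fun l => Real.exp (x.1 l)) x.2 i),
   fun i => -(Ftilde2 G (fun l => Real.exp (x.1 l)) x.2 i))

theorem hrf_field_lip {N : ℕ} (hN : 1 ≤ N) (k : ℝ) {G : (Fin N → ℝ) → (Fin N → ℝ)}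
    (hGdiff : Differentiable ℝ G)
    (hGlip : ∀ i j : Fin N, LocallyLipschitz (fun U => (fderiv ℝ G U) (Pi.single j 1) i)) :
    LocallyLipschitz (hrfField k G) := by
  have hne : Nonempty (Fin N) := ⟨⟨0, hN⟩⟩
  have hG : ContDiff ℝ 1 G := by
    refine contDiff_one_iff_fderiv.2 ⟨hGdiff, continuous_clm_apply.2 fun y => ?_⟩
    have : (fun U => fderiv ℝ G U y) = fun U => ∑ j, y j • fderiv ℝ G U (Pi.single j 1) := by
      funext U
      conv_lhs => rw [pi_eq_sum_univ' y]
      simp only [map_sum, map_smul]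
    rw [this]
    refine continuous_finsetSum _ fun j _ => ?_
    have hj : Continuous (fun U => fderiv ℝ G U (Pi.single j 1)) :=
      continuous_pi fun i => (hGlip i j).continuous
    exact hj.const_smul (y j)
  have hGi : ∀ i, ContDiff ℝ 1 (fun U => G U i) := contDiff_pi.1 hG
  have hY : ∀ i, ContDiff ℝ 1 (fun x : (Fin N → ℝ) × (Fin N → ℝ) => x.1 i) :=
    fun i => (contDiff_apply ℝ ℝ i).comp contDiff_fst
  have hGx : ∀ i, ContDiff ℝ 1 (fun x : (Fin N → ℝ) × (Fin N → ℝ) => G x.2 i) :=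
    fun i => (hGi i).comp contDiff_snd
  unfold hrfField
  refine LocallyLipschitz.prodMk (hrf_lip_pi fun i => ?_) (hrf_lip_pi fun j => ?_)
  · refine ContDiff.locallyLipschitz (𝕂 := ℝ) ?_
    simp only [Ftilde1, Htilde, Real.log_exp]
    refine ContDiff.neg (((hGx i).neg.add (ContDiff.div ?_ ?_ ?_)).add (contDiff_const.mul (hY i)))
    · exact ContDiff.sum fun l _ => ((hY l).exp.mul (hGx l)).sub
        (contDiff_const.mul ((hY l).exp.mul (hY l)))
    · exact ContDiff.sum fun l _ => (hY l).exp
    · intro x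
      exact (Finset.sum_pos (fun l _ => Real.exp_pos _) Finset.univ_nonempty).ne'
  · simp only [Ftilde2, ← Finset.sum_neg_distrib]
    have : ∀ s : Finset (Fin N), LocallyLipschitz (fun x : (Fin N → ℝ) × (Fin N → ℝ) =>
        ∑ l ∈ s, -(Real.exp (x.1 l) * (fderiv ℝ G x.2) (Pi.single j 1) l)) := by
      intro s
      induction s using Finset.induction_on with
      | empty => simpa using LocallyLipschitz.const (0:ℝ)
      | insert a s ha ih =>
        simp only [Finset.sum_insert ha]
        refine LocallyLipschitz.add ?_ ih
        have h1 : LocallyLipschitz (fun x : (Fin N → ℝ) × (Fin N → ℝ) => -Real.exp (x.1 a)) :=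
          (hY a).exp.neg.locallyLipschitz
        have h2 : LocallyLipschitz (fun x : (Fin N → ℝ) × (Fin N → ℝ) =>
            (fderiv ℝ G x.2) (Pi.single j 1) a) :=
          (hGlip a j).comp (contDiff_snd (𝕜 := ℝ) (n := 1)).locallyLipschitz
        simpa using hrf_lip_smul h1 h2
    exact this _

theorem hrf_apriori {N : ℕ} (hN : 1 ≤ N) {k : ℝ} (hk : 0 < k)
    {G : (Fin N → ℝ) → (Fin N → ℝ)} (hGdiff : Differentiable ℝ G)
    (hGconv : ∀ i : Fin N, ConvexOn ℝ Set.univ (fun U => G U i))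
    {Ms Us : Fin N → ℝ} (hMs : ∀ i, 0 < Ms i)
    (hstar1 : ∀ i, Ftilde1 k G Ms Us i = 0) (hstar2 : ∀ j, Ftilde2 G Ms Us j = 0)
    (x₀ : (Fin N → ℝ) × (Fin N → ℝ))
    (hmass : ∑ i, Real.exp (x₀.1 i) = ∑ i, Ms i) :
    ∃ R : ℝ, ∀ c : (Fin N → ℝ) × (Fin N → ℝ) → ℝ, (∀ x, 0 ≤ c x) →
      ∀ x : ℝ → (Fin N → ℝ) × (Fin N → ℝ), x 0 = x₀ →
      (∀ t, HasDerivAt x (c (x t) • hrfField k G (x t)) t) → ∀ t, 0 ≤ t → ‖x t‖ ≤ R := by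
  have hne : Nonempty (Fin N) := ⟨⟨0, hN⟩⟩
  have hMspos : 0 < ∑ i, Ms i := Finset.sum_pos (fun i _ => hMs i) Finset.univ_nonempty
  set l : ℝ := Real.log (∑ i, Ms i) with hl
  let W : (Fin N → ℝ) × (Fin N → ℝ) → ℝ := fun x =>
    ∑ i, Ms i * (l - x.1 i) + ∑ i, (1/2) * (x.2 i - Us i) ^ 2
  set B := W x₀ with hB
  refine ⟨|l| + ∑ i, |B| / Ms i + ‖Us‖ + 2 * |B| + 1, ?_⟩
  intro c hc x h0 hx t ht
  have hx1 : ∀ t i, HasDerivAt (fun s => (x s).1 i)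
      (c (x t) * -(Ftilde1 k G (fun l => Real.exp ((x t).1 l)) (x t).2 i)) t := by
    intro t i
    exact hasDerivAt_pi.1 ((hasFDerivAt_fst (𝕜 := ℝ)).comp_hasDerivAt t (hx t)) i
  have hx2 : ∀ t i, HasDerivAt (fun s => (x s).2 i)
      (c (x t) * -(Ftilde2 G (fun l => Real.exp ((x t).1 l)) (x t).2 i)) t := by
    intro t i
    exact hasDerivAt_pi.1 ((hasFDerivAt_snd (𝕜 := ℝ)).comp_hasDerivAt t (hx t)) i
  have hpos : ∀ t, ∑ i, Real.exp ((x t).1 i) ≠ 0 := fun t =>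
    (Finset.sum_pos (fun l _ => Real.exp_pos _) Finset.univ_nonempty).ne'
  have hm : ∀ t, ∑ i, Real.exp ((x t).1 i) = ∑ i, Ms i := by
    have hd : ∀ t, HasDerivAt (fun s => ∑ i, Real.exp ((x s).1 i)) 0 t := by
      intro t
      have := HasDerivAt.fun_sum (u := Finset.univ) (fun i _ => (hx1 t i).exp)
      convert! this using 1
      have h := hrf_mass k G (fun l => Real.exp ((x t).1 l)) (x t).2 (hpos t)
      have h' : ∑ i, Real.exp ((x t).1 i) * (c (x t) *
          -(Ftilde1 k G (fun l => Real.exp ((x t).1 l)) (x t).2 i)) = -(c (x t)) *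
          ∑ i, Real.exp ((x t).1 i) * Ftilde1 k G (fun l => Real.exp ((x t).1 l)) (x t).2 i := by
        rw [Finset.mul_sum]
        exact Finset.sum_congr rfl fun i _ => by ring
      rw [h', h, mul_zero]
    intro t
    rw [← hmass, ← h0]
    exact is_const_of_deriv_eq_zero (fun t => (hd t).differentiableAt)
      (fun t => (hd t).deriv) t 0
  have hW : Antitone (fun t => W (x t)) := by
    refine antitone_of_hasDerivAt_nonpos (f' := fun t => c (x t) *
      (∑ i, Ms i * Ftilde1 k G (fun l => Real.exp ((x t).1 l)) (x t).2 i
        - ∑ j, ((x t).2 j - Us j) * Ftilde2 G (fun l => Real.exp ((x t).1 l)) (x t).2 j)) ?_ ?_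
    · intro t
      have h1 := HasDerivAt.fun_sum (u := Finset.univ)
        (fun i _ => ((hx1 t i).const_sub l).const_mul (Ms i))
      have h2 := HasDerivAt.fun_sum (u := Finset.univ)
        (fun i _ => (((hx2 t i).sub_const (Us i)).fun_pow 2).const_mul (1/2))
      convert! h1.add h2 using 1
      rw [mul_sub, Finset.mul_sum, Finset.mul_sum, sub_eq_add_neg, ← Finset.sum_neg_distrib]
      congr 1
      · exact Finset.sum_congr rfl fun i _ => by ring
      · exact Finset.sum_congr rfl fun i _ => by norm_num; ring
    · intro t
      exact mul_nonpos_of_nonneg_of_nonpos (hc _)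
        (hrf_lyapunov hk hGdiff hGconv hMs hstar1 hstar2 _ (fun i => Real.exp_pos _) (hm t) (hpos t))
  have hWt : W (x t) ≤ B := by
    have := hW ht
    simpa [h0] using this
  have hYl : ∀ i, (x t).1 i ≤ l := by
    intro i
    rw [hl, Real.le_log_iff_exp_le hMspos, ← hm t]
    exact Finset.single_le_sum (f := fun i => Real.exp ((x t).1 i))
      (fun _ _ => (Real.exp_pos _).le) (Finset.mem_univ i)
  have ht1 : ∀ i, 0 ≤ Ms i * (l - (x t).1 i) := fun i =>
    mul_nonneg (hMs i).le (by linarith [hYl i])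
  have ht2 : ∀ i, 0 ≤ (1/2) * ((x t).2 i - Us i) ^ 2 := fun i => by positivity
  have hs1 : 0 ≤ ∑ i, Ms i * (l - (x t).1 i) := Finset.sum_nonneg fun i _ => ht1 i
  have hs2 : 0 ≤ ∑ i, (1/2) * ((x t).2 i - Us i) ^ 2 := Finset.sum_nonneg fun i _ => ht2 i
  have hWe : ∑ i, Ms i * (l - (x t).1 i) + ∑ i, (1/2) * ((x t).2 i - Us i) ^ 2 ≤ B := hWt
  have hBabs := le_abs_self B
  have hB0 := abs_nonneg B
  have hl0 := abs_nonneg l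
  have hU0 := norm_nonneg Us
  have hsum0 : 0 ≤ ∑ i, |B| / Ms i :=
    Finset.sum_nonneg fun i _ => div_nonneg hB0 (hMs i).le
  rw [Prod.norm_def]
  refine max_le ?_ ?_
  · rw [pi_norm_le_iff_of_nonneg (by linarith)]
    intro i
    have a1 : Ms i * (l - (x t).1 i) ≤ |B| := by
      have := Finset.single_le_sum (f := fun i => Ms i * (l - (x t).1 i))
        (fun i _ => ht1 i) (Finset.mem_univ i)
      linarith
    have a2 : l - (x t).1 i ≤ |B| / Ms i := by
      rw [le_div_iff₀ (hMs i)]; linarith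
    have a3 : |B| / Ms i ≤ ∑ i, |B| / Ms i :=
      Finset.single_le_sum (f := fun i => |B| / Ms i)
        (fun i _ => div_nonneg hB0 (hMs i).le) (Finset.mem_univ i)
    rw [Real.norm_eq_abs, abs_le]
    constructor
    · linarith [neg_abs_le l]
    · linarith [le_abs_self l, hYl i]
  · rw [pi_norm_le_iff_of_nonneg (by linarith)]
    intro i
    have a1 : (1/2) * ((x t).2 i - Us i) ^ 2 ≤ |B| := by
      have := Finset.single_le_sum (f := fun i => (1/2) * ((x t).2 i - Us i) ^ 2)
        (fun i _ => ht2 i) (Finset.mem_univ i)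
      linarith
    have a2 : |(x t).2 i - Us i| ≤ 2 * |B| + 1 := by
      rw [← sq_abs] at a1
      nlinarith [abs_nonneg ((x t).2 i - Us i)]
    have a3 : |Us i| ≤ ‖Us‖ := norm_le_pi_norm Us i
    rw [abs_le] at a2 a3
    rw [Real.norm_eq_abs, abs_le]
    constructor <;> linarith [a2.1, a2.2, a3.1, a3.2]

/-- global existence and uniqueness (among positive solutions) of the discrete
Hessian Riemannian flow `(Ṁ,U̇) = −F̄(M,U)` on `[0,∞)`, for any positive initial condition
of mass `1`, assuming the discrete stationary problem `F̃ = 0` has a positive solution of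
mass `1`; moreover the solution keeps all components of `M` strictly positive. -/
theorem discrete_HRF_global_existence_uniqueness
    (N : ℕ) (hN : 1 ≤ N) (k : ℝ) (hk : 0 < k)
    (G : (Fin N → ℝ) → (Fin N → ℝ))
    (hGdiff : Differentiable ℝ G)
    (hGconv : ∀ i : Fin N, ConvexOn ℝ Set.univ (fun U => G U i))
    (hGlip : ∀ i j : Fin N, LocallyLipschitz (fun U => (fderiv ℝ G U) (Pi.single j 1) i))
    (Mstar Ustar : Fin N → ℝ)
    (hMstarpos : ∀ i, 0 < Mstar i)
    (hstarmass : (1 / (N : ℝ)) * ∑ i, Mstar i = 1)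
    (hstar1 : ∀ i, Ftilde1 k G Mstar Ustar i = 0)
    (hstar2 : ∀ j, Ftilde2 G Mstar Ustar j = 0)
    (M0 U0 : Fin N → ℝ)
    (hM0pos : ∀ i, 0 < M0 i)
    (hM0mass : (1 / (N : ℝ)) * ∑ i, M0 i = 1) :
    ∃ M U : ℝ → Fin N → ℝ,
      (M 0 = M0 ∧ U 0 = U0) ∧
      (∀ t, 0 ≤ t → ∀ i, 0 < M t i) ∧
      (∀ t, 0 ≤ t → ∀ i,
        HasDerivAt (fun s => M s i) (-(Fbar1 k G (M t) (U t) i)) t ∧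
        HasDerivAt (fun s => U s i) (-(Ftilde2 G (M t) (U t) i)) t) ∧
      (∀ M' U' : ℝ → Fin N → ℝ,
        (M' 0 = M0 ∧ U' 0 = U0) →
        (∀ t, 0 ≤ t → ∀ i, 0 < M' t i) →
        (∀ t, 0 ≤ t → ∀ i,
          HasDerivAt (fun s => M' s i) (-(Fbar1 k G (M' t) (U' t) i)) t ∧
          HasDerivAt (fun s => U' s i) (-(Ftilde2 G (M' t) (U' t) i)) t) →
        ∀ t, 0 ≤ t → M' t = M t ∧ U' t = U t) := by
  have hNpos : (0:ℝ) < N := by exact_mod_cast hN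
  have hmul : ∀ s : ℝ, (1 / (N : ℝ)) * s = 1 → s = N := by
    intro s hs
    field_simp at hs
    linarith
  have hlip := hrf_field_lip hN k hGdiff hGlip
  have hmass0 : ∑ i, Real.exp (Real.log (M0 i)) = ∑ i, Mstar i := by
    simp only [Real.exp_log (hM0pos _)]
    rw [hmul _ hstarmass, hmul _ hM0mass]
  obtain ⟨R, hR⟩ := hrf_apriori hN hk hGdiff hGconv hMstarpos hstar1 hstar2
    (fun i => Real.log (M0 i), U0) hmass0
  obtain ⟨x, h0, hx⟩ := hrf_ode_global hlip _ R hR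
  refine ⟨fun t i => Real.exp ((x t).1 i), fun t => (x t).2, ⟨?_, ?_⟩, ?_, ?_, ?_⟩
  · funext i
    simp only [h0]
    exact Real.exp_log (hM0pos i)
  · simp only [h0]
  · intro t _ i
    exact Real.exp_pos _
  · intro t ht i
    have h1 : HasDerivAt (fun s => (x s).1 i)
        (-(Ftilde1 k G (fun l => Real.exp ((x t).1 l)) (x t).2 i)) t :=
      hasDerivAt_pi.1 ((hasFDerivAt_fst (𝕜 := ℝ)).comp_hasDerivAt t (hx t ht)) i
    have h2 : HasDerivAt (fun s => (x s).2 i)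
        (-(Ftilde2 G (fun l => Real.exp ((x t).1 l)) (x t).2 i)) t :=
      hasDerivAt_pi.1 ((hasFDerivAt_snd (𝕜 := ℝ)).comp_hasDerivAt t (hx t ht)) i
    refine ⟨?_, h2⟩
    have := h1.exp
    rw [mul_neg] at this
    exact this
  · intro M' U' hinit hpos hder t ht
    let y : ℝ → (Fin N → ℝ) × (Fin N → ℝ) := fun s => (fun i => Real.log (M' s i), U' s)
    have hy : ∀ s, 0 ≤ s → HasDerivAt y (hrfField k G (y s)) s := by
      intro s hs
      have he : (fun l => Real.exp ((y s).1 l)) = M' s := by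
        funext l
        exact Real.exp_log (hpos s hs l)
      have h1 : HasDerivAt (fun s i => Real.log (M' s i))
          (fun i => -(Ftilde1 k G (M' s) (U' s) i)) s := by
        refine hasDerivAt_pi.2 fun i => ?_
        have := (hder s hs i).1.log (hpos s hs i).ne'
        convert! this using 1
        have := (hpos s hs i).ne'
        unfold Fbar1
        field_simp
      have h2 : HasDerivAt U' (fun i => -(Ftilde2 G (M' s) (U' s) i)) s :=
        hasDerivAt_pi.2 fun i => (hder s hs i).2
      have h3 := h1.prodMk h2
      unfold hrfField
      rw [he]
      exact h3
    have hy0 : y 0 = x 0 := by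
      rw [h0]
      simp only [y, hinit.1, hinit.2]
    have hxy := hrf_ode_unique hlip (a := 0) (b := t + 1) (t₀ := 0) ⟨le_rfl, by linarith⟩
      (Or.inl rfl) (fun s hs => hy s hs.1) (fun s hs => hx s hs.1) hy0
      (show t ∈ Icc 0 (t + 1) from ⟨ht, by linarith⟩)
    beta_reduce
    rw [← hxy]
    refine ⟨?_, rfl⟩
    funext i
    exact (Real.exp_log (hpos t ht i)).symm
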